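/- Second algebraic identity in the gauge-variation computation: for every ε ∈ 𝔄 and each index a ∈ {0,1,2,3}, Σ_{c=0}^{3} ( [D_c ε, F^{ca}] − i [A_c, [F^{ca}, ε]] ) = Σ_{c=0}^{3} ∂_c[ε, F^{ca}] − [ε, ψ^a]. -/

import Mathlib

open Complex

namespace NC

/-- Commutator in an associative algebra. -/
def br {𝔄 : Type*} [Ring 𝔄] (X Y : 𝔄) : 𝔄 := X * Y - Y * X

/-- Minkowski metric diag(-1,1,1,1), as a family of scalars. -/
def η : Fin 4 → ℂ := fun a => if a = 0 then -1 else 1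

variable {𝔄 : Type*} [Ring 𝔄] [Algebra ℂ 𝔄]

/-- Field strength F_{ab} = ∂_a A_b - ∂_b A_a - i [A_a, A_b]. -/
def F (d : Fin 4 → 𝔄 →ₗ[ℂ] 𝔄) (A : Fin 4 → 𝔄) (a b : Fin 4) : 𝔄 :=
  d a (A b) - d b (A a) - I • br (A a) (A b)

/-- Field strength with both indices raised: F^{ac} = η^{aa} η^{cc} F_{ac}. -/
def Fup (d : Fin 4 → 𝔄 →ₗ[ℂ] 𝔄) (A : Fin 4 → 𝔄) (a c : Fin 4) : 𝔄 :=
  (η a * η c) • F d A a c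

/-- Covariant derivative D_a X = ∂_a X - i [A_a, X]. -/
def D (d : Fin 4 → 𝔄 →ₗ[ℂ] 𝔄) (A : Fin 4 → 𝔄) (a : Fin 4) (X : 𝔄) : 𝔄 :=
  d a X - I • br (A a) X

/-- Wave operator □X = Σ_a ∂^a (∂_a X). -/
def box (d : Fin 4 → 𝔄 →ₗ[ℂ] 𝔄) (X : 𝔄) : 𝔄 :=
  ∑ a : Fin 4, η a • d a (d a X)

/-- Nonlinear current Λ^c = -i Σ_a ∂_a [A^a, A^c] - i Σ_a [A_a, F^{ac}]. -/
def Λ (d : Fin 4 → 𝔄 →ₗ[ℂ] 𝔄) (A : Fin 4 → 𝔄) (c : Fin 4) : 𝔄 :=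
  (-I) • ∑ a : Fin 4, d a (br (η a • A a) (η c • A c))
    - I • ∑ a : Fin 4, br (A a) (Fup d A a c)

/-- Field-equation expression ψ^c = □A^c - ∂^c(Σ_a ∂_a A^a) + Λ^c. -/
def ψ (d : Fin 4 → 𝔄 →ₗ[ℂ] 𝔄) (A : Fin 4 → 𝔄) (c : Fin 4) : 𝔄 :=
  box d (η c • A c) - η c • d c (∑ a : Fin 4, d a (η a • A a)) + Λ d A c

/-- Explicit first-order gauge variation of Λ^c under δA_a = D_a ε,
    with δF^{ac} = -i [F^{ac}, ε] substituted. -/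
def δΛ (d : Fin 4 → 𝔄 →ₗ[ℂ] 𝔄) (A : Fin 4 → 𝔄) (ε : 𝔄) (c : Fin 4) : 𝔄 :=
  (-I) • ∑ a : Fin 4,
      d a (br (η a • D d A a ε) (η c • A c) + br (η a • A a) (η c • D d A c ε))
    - I • ∑ a : Fin 4,
      (br (D d A a ε) (Fup d A a c) + br (A a) ((-I) • br (Fup d A a c) ε))

/-- The commutator satisfies the Jacobi identity. -/
theorem br_jacobi {R : Type*} [Ring R] (X Y Z : R) : br (br X Y) Z + br X (br Z Y) = br (br X Z) Y := by
  simp only [br]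
  noncomm_ring

theorem br_antisymm {R : Type*} [Ring R] (X Y : R) : -br X Y = br Y X := by
  simp only [br, neg_sub]

theorem br_sub_left {R : Type*} [Ring R] (X Y Z : R) : br (X - Y) Z = br X Z - br Y Z := by
  simp only [br]
  noncomm_ring

theorem br_sub_right {R : Type*} [Ring R] (X Y Z : R) : br X (Y - Z) = br X Y - br X Z := by
  simp only [br]
  noncomm_ring

theorem br_sum_right {R ι : Type*} [Ring R] (s : Finset ι) (X : R) (Y : ι → R) :
    br X (∑ i ∈ s, Y i) = ∑ i ∈ s, br X (Y i) := by
  simp only [br, Finset.mul_sum, Finset.sum_mul, Finset.sum_sub_distrib]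

theorem br_smul_left (z : ℂ) (X Y : 𝔄) : br (z • X) Y = z • br X Y := by
  simp only [br, smul_mul_assoc, mul_smul_comm, smul_sub]

theorem br_smul_right (z : ℂ) (X Y : 𝔄) : br X (z • Y) = z • br X Y := by
  simp only [br, smul_mul_assoc, mul_smul_comm, smul_sub]

/-- A derivation of the product is a derivation of the commutator. -/
theorem map_br (δ : 𝔄 →ₗ[ℂ] 𝔄) (hδ : ∀ x y : 𝔄, δ (x * y) = δ x * y + x * δ y) (X Y : 𝔄) :
    δ (br X Y) = br (δ X) Y + br X (δ Y) := by
  simp only [br, map_sub, hδ]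
  abel

/-- The field-equation expression is the covariant divergence of the field strength. -/
theorem ψ_eq_sum_D_Fup (d : Fin 4 → 𝔄 →ₗ[ℂ] 𝔄)
    (hComm : ∀ (a b : Fin 4) (x : 𝔄), d a (d b x) = d b (d a x)) (A : Fin 4 → 𝔄) (a : Fin 4) :
    ψ d A a = ∑ c : Fin 4, D d A c (Fup d A c a) := by
  simp only [ψ, box, Λ, D, map_sum, Finset.smul_sum, ← Finset.sum_sub_distrib,
    ← Finset.sum_add_distrib]
  refine Finset.sum_congr rfl fun c _ => ?_
  have hdiv : d c (Fup d A c a) = (η c * η a) • (d c (d c (A a)) - d a (d c (A c))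
      - I • d c (br (A c) (A a))) := by
    rw [Fup, F, map_smul, map_sub, map_sub, map_smul, hComm c a]
  rw [hdiv]
  simp only [map_smul, br_smul_left, br_smul_right]
  module

/-- Second algebraic identity of the gauge-variation computation:
    Σ_c ([D_c ε, F^{ca}] - i [A_c, [F^{ca}, ε]]) = Σ_c ∂_c[ε, F^{ca}] - [ε, ψ^a]. -/
theorem gauge_variation_identity_two {𝔄 : Type*} [Ring 𝔄] [Algebra ℂ 𝔄]
    (d : Fin 4 → 𝔄 →ₗ[ℂ] 𝔄)
    (hLeib : ∀ (a : Fin 4) (x y : 𝔄), d a (x * y) = d a x * y + x * d a y)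
    (hComm : ∀ (a b : Fin 4) (x : 𝔄), d a (d b x) = d b (d a x))
    (A : Fin 4 → 𝔄) (ε : 𝔄) (a : Fin 4) :
    ∑ c : Fin 4, (br (D d A c ε) (Fup d A c a) - I • br (A c) (br (Fup d A c a) ε))
      = ∑ c : Fin 4, d c (br ε (Fup d A c a)) - br ε (ψ d A a) := by
  rw [ψ_eq_sum_D_Fup d hComm, br_sum_right, ← Finset.sum_sub_distrib]
  refine Finset.sum_congr rfl fun c _ => ?_
  rw [map_br (d c) (hLeib c)]
  simp only [D, br_sub_left, br_sub_right, br_smul_left, br_smul_right]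
  rw [← br_antisymm (br (A c) (Fup d A c a)) ε, ← br_jacobi (A c) ε (Fup d A c a)]
  module

end NC
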